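/- Let N ≥ 1 and let φ₁, φ₂ : ℝ → ℂ be 1-periodic and N-times continuously differentiable. Then for every k with 1 ≤ k ≤ N+1 one has the identity ∫₀¹ φ₁(t)·r_k(t) dt = ∫₀¹ φ₂(t)·s_k(t) dt, where r_k and s_k are the recursively defined coefficient functions of the WKB expansion. -/

import Mathlib

open MeasureTheory

noncomputable section

open PowerSeries in
/-- `F` has the coefficientwise derivative `F'` at `t` in all degrees below `m`. -/
def HasCoeffDerivAt (F : ℝ → PowerSeries ℂ) (F' : PowerSeries ℂ) (t : ℝ) (m : ℕ) : Prop :=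
  ∀ i < m, HasDerivAt (fun x => coeff i (F x)) (coeff i F') t

namespace HasCoeffDerivAt

open PowerSeries

variable {F G : ℝ → PowerSeries ℂ} {F' G' : PowerSeries ℂ} {t : ℝ} {m : ℕ}

theorem mul (hF : HasCoeffDerivAt F F' t m) (hG : HasCoeffDerivAt G G' t m) :
    HasCoeffDerivAt (fun x => F x * G x) (F' * G t + F t * G') t m := by
  intro i hi
  simp only [coeff_mul, map_add, ← Finset.sum_add_distrib]
  refine HasDerivAt.fun_sum fun p hp => ?_
  have hp' := Finset.HasAntidiagonal.mem_antidiagonal.1 hp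
  exact (hF p.1 (by omega)).mul (hG p.2 (by omega))

theorem pow_succ (hF : HasCoeffDerivAt F F' t m) (n : ℕ) :
    HasCoeffDerivAt (fun x => F x ^ (n + 1)) (C (n + 1 : ℂ) * (F t ^ n * F')) t m := by
  induction n with
  | zero => simpa using hF
  | succ n ih =>
    have h := ih.mul hF
    have hF' : C (n + 1 : ℂ) * (F t ^ n * F') * F t + F t ^ (n + 1) * F' =
        C ((n + 1 : ℕ) + 1 : ℂ) * (F t ^ (n + 1) * F') := by
      simp only [Nat.cast_add, Nat.cast_one, map_add, map_one]
      ring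
    simpa only [hF', ← _root_.pow_succ] using h

theorem X_pow_mul (hF : HasCoeffDerivAt F F' t m) (d : ℕ) :
    HasCoeffDerivAt (fun x => X ^ d * F x) (X ^ d * F') t (m + d) := by
  intro i hi
  simp only [coeff_X_pow_mul']
  split_ifs
  · exact hF _ (by omega)
  · exact hasDerivAt_const _ _

/-- Logarithmic derivative: if `F' = (1 + F) f`, then the degree `k` coefficient of
`log (1 + F)` has derivative the degree `k` coefficient of `f`. -/
theorem log_one_add {f : PowerSeries ℂ} (hF : HasCoeffDerivAt F ((1 + F t) * f) t m)
    (hF0 : X ∣ F t) (hf0 : X ∣ f) {k : ℕ} (hk : k < m) :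
    HasDerivAt (fun x => ∑ j ∈ Finset.range k, (-1) ^ j / (j + 1 : ℂ) * coeff k (F x ^ (j + 1)))
      (coeff k f) t := by
  have h : HasDerivAt
      (fun x => ∑ j ∈ Finset.range k, (-1) ^ j / (j + 1 : ℂ) * coeff k (F x ^ (j + 1)))
      (∑ j ∈ Finset.range k, (-1) ^ j / (j + 1 : ℂ) *
        coeff k (C (j + 1 : ℂ) * (F t ^ j * ((1 + F t) * f)))) t :=
    HasDerivAt.fun_sum fun j _ => (hF.pow_succ j k hk).const_mul _
  convert h using 1
  have hterm : ∀ j ∈ Finset.range k, (-1) ^ j / (j + 1 : ℂ) *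
        coeff k (C (j + 1 : ℂ) * (F t ^ j * ((1 + F t) * f))) =
      coeff k ((-F t) ^ j * ((1 + F t) * f)) := by
    intro j _
    have hj : (j + 1 : ℂ) ≠ 0 := Nat.cast_add_one_ne_zero j
    have hneg : (-F t) ^ j * ((1 + F t) * f) =
        C ((-1 : ℂ) ^ j) * (F t ^ j * ((1 + F t) * f)) := by
      rw [neg_pow, map_pow, map_neg, map_one, mul_assoc]
    rw [hneg, coeff_C_mul, coeff_C_mul]
    field_simp
  rw [Finset.sum_congr rfl hterm, ← map_sum, ← Finset.sum_mul]
  have hgeom : (∑ j ∈ Finset.range k, (-F t) ^ j) * ((1 + F t) * f) = f - (-F t) ^ k * f := by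
    linear_combination f * mul_neg_geom_sum (-F t) k
  have hzero : coeff k ((-F t) ^ k * f) = 0 := by
    have hdvd : (X : PowerSeries ℂ) ^ (k + 1) ∣ (-F t) ^ k * f := by
      rw [_root_.pow_succ]
      exact mul_dvd_mul (pow_dvd_pow_of_dvd ((dvd_neg).2 hF0) k) hf0
    exact X_pow_dvd_iff.1 hdvd k (Nat.lt_succ_self k)
  rw [hgeom, map_sub, hzero, sub_zero]

end HasCoeffDerivAt

theorem Finset.sum_antidiagonal_succ_eq_sum_Ico {M : Type*} [AddCommMonoid M]
    (g : ℕ → ℕ → M) (n : ℕ) :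
    ∑ p ∈ Finset.HasAntidiagonal.antidiagonal n, g (p.1 + 1) (p.2 + 1) =
      ∑ k ∈ Finset.Ico 1 (n + 2), g k (n + 2 - k) := by
  rw [Finset.Nat.sum_antidiagonal_eq_sum_range_succ (fun i j => g (i + 1) (j + 1)),
    Finset.sum_Ico_eq_sum_range]
  refine Finset.sum_congr rfl fun k hk => ?_
  have := Finset.mem_range.1 hk
  rw [add_comm 1 k]
  congr 1
  omega

section Recursion

variable {N : ℕ} {φ ψ : ℝ → ℂ} {r : ℕ → ℝ → ℂ} {ε : ℂ}

theorem contDiff_of_riccati_recursion (hφ : ContDiff ℝ N φ) (hψ : ContDiff ℝ N ψ)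
    (h1 : ∀ t, r 1 t = -ψ t)
    (hrec : ∀ n, 1 ≤ n → n ≤ N → ∀ t,
      r (n + 1) t = ε * deriv (r n) t + φ t * ∑ k ∈ Finset.Ico 1 n, r k t * r (n - k) t)
    (n : ℕ) (hn : 1 ≤ n) (hnN : n ≤ N + 1) : ContDiff ℝ (N + 1 - n : ℕ) (r n) := by
  induction n using Nat.strong_induction_on with
  | _ n ih =>
    obtain rfl | ⟨n, rfl, hn'⟩ : n = 1 ∨ ∃ q, n = q + 1 ∧ 1 ≤ q := by
      rcases n with _ | _ | q
      · omega
      · exact Or.inl rfl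
      · exact Or.inr ⟨q + 1, rfl, by omega⟩
    · rw [funext h1]
      exact hψ.neg
    · rw [funext (hrec n hn' (by omega))]
      have hle : ∀ {a b : ℕ}, a ≤ b → (a : WithTop ℕ∞) ≤ b := fun h => by exact_mod_cast h
      have hd : ContDiff ℝ (N + 1 - (n + 1) : ℕ) (deriv (r n)) := by
        have h := ih n (by omega) hn' (by omega)
        rw [show N + 1 - n = N + 1 - (n + 1) + 1 by omega, Nat.cast_add, Nat.cast_one] at h
        exact h.deriv'
      refine (contDiff_const.mul hd).add
        ((hφ.of_le (hle (by omega))).mul (ContDiff.sum fun k hk => ?_))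
      have hk' := Finset.mem_Ico.1 hk
      exact ((ih k (by omega) (by omega) (by omega)).of_le (hle (by omega))).mul
        ((ih (n - k) (by omega) (by omega) (by omega)).of_le (hle (by omega)))

theorem periodic_of_riccati_recursion (hφ : Function.Periodic φ 1) (hψ : Function.Periodic ψ 1)
    (h1 : ∀ t, r 1 t = -ψ t)
    (hrec : ∀ n, 1 ≤ n → n ≤ N → ∀ t,
      r (n + 1) t = ε * deriv (r n) t + φ t * ∑ k ∈ Finset.Ico 1 n, r k t * r (n - k) t)
    (n : ℕ) (hn : 1 ≤ n) (hnN : n ≤ N + 1) : Function.Periodic (r n) 1 := by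
  induction n using Nat.strong_induction_on with
  | _ n ih =>
    obtain rfl | ⟨n, rfl, hn'⟩ : n = 1 ∨ ∃ q, n = q + 1 ∧ 1 ≤ q := by
      rcases n with _ | _ | q
      · omega
      · exact Or.inl rfl
      · exact Or.inr ⟨q + 1, rfl, by omega⟩
    · intro t
      rw [h1, h1, hψ]
    · intro t
      have hd : deriv (r n) (t + 1) = deriv (r n) t := by
        rw [← deriv_comp_add_const, funext (ih n (by omega) hn' (by omega))]
      rw [hrec n hn' (by omega), hrec n hn' (by omega), hd, hφ]
      congr 2
      refine Finset.sum_congr rfl fun k hk => ?_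
      have hk' := Finset.mem_Ico.1 hk
      rw [ih k (by omega) (by omega) (by omega) t,
        ih (n - k) (by omega) (by omega) (by omega) t]

open PowerSeries in
/-- The truncated generating series of a recursion solution satisfies a Riccati equation. -/
theorem exists_riccati_series (hφ : ContDiff ℝ N φ) (hψ : ContDiff ℝ N ψ)
    (hφp : Function.Periodic φ 1) (hψp : Function.Periodic ψ 1) (hε : ε * ε = 1)
    (h1 : ∀ t, r 1 t = -ψ t)
    (hrec : ∀ n, 1 ≤ n → n ≤ N → ∀ t,
      r (n + 1) t = ε * deriv (r n) t + φ t * ∑ k ∈ Finset.Ico 1 n, r k t * r (n - k) t) :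
    ∃ R R' : ℝ → PowerSeries ℂ,
      (∀ i ≤ N, ∀ t, coeff i (R t) = r (i + 1) t) ∧ R 1 = R 0 ∧
      (∀ t, HasCoeffDerivAt R (R' t) t N) ∧
      ∀ t, R t = C ε * (X * R' t) + C (φ t) * (X ^ 2 * R t ^ 2) - C (ψ t) := by
  set R : ℝ → PowerSeries ℂ := fun t => mk fun i => if i ≤ N then r (i + 1) t else 0 with hR
  have hcoeff : ∀ i ≤ N, ∀ t, coeff i (R t) = r (i + 1) t := fun i hi t => by
    simp [hR, hi]
  set Q : ℝ → PowerSeries ℂ := fun t => R t - C (φ t) * (X ^ 2 * R t ^ 2) with hQ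
  refine ⟨R, fun t => C ε * mk fun i => coeff (i + 1) (Q t), hcoeff, ?_, fun t i hi => ?_,
    fun t => ?_⟩
  · ext i
    by_cases hi : i ≤ N
    · rw [hcoeff i hi, hcoeff i hi]
      simpa using periodic_of_riccati_recursion hφp hψp h1 hrec (i + 1) (by omega) (by omega) 0
    · simp [hR, hi]
  · have hd : DifferentiableAt ℝ (r (i + 1)) t :=
      ((contDiff_of_riccati_recursion hφ hψ h1 hrec (i + 1) (by omega) (by omega)).differentiable
        (by norm_cast; omega)) t
    rw [funext (hcoeff i hi.le)]
    refine hd.hasDerivAt.congr_deriv (Eq.symm ?_)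
    rw [coeff_C_mul, coeff_mk, hQ]
    simp only [map_sub, coeff_C_mul, hcoeff (i + 1) hi]
    have hsq : coeff (i + 1) (X ^ 2 * R t ^ 2) =
        ∑ k ∈ Finset.Ico 1 (i + 1), r k t * r (i + 1 - k) t := by
      rw [coeff_X_pow_mul']
      rcases i with _ | i
      · simp
      · rw [if_pos (by omega), show i + 1 + 1 - 2 = i by omega, sq, coeff_mul,
          ← Finset.sum_antidiagonal_succ_eq_sum_Ico (fun a b => r a t * r b t)]
        refine Finset.sum_congr rfl fun p hp => ?_
        have hp' := Finset.HasAntidiagonal.mem_antidiagonal.1 hp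
        rw [hcoeff p.1 (by omega), hcoeff p.2 (by omega)]
    rw [hsq, hrec (i + 1) (by omega) (by omega)]
    linear_combination deriv (r (i + 1)) t * hε
  · have hshift := sub_const_eq_X_mul_shift (Q t)
    have hconst : constantCoeff (Q t) = -ψ t := by
      rw [← h1, ← zero_add 1, ← hcoeff 0 (Nat.zero_le N)]
      simp [hQ]
    rw [hconst, map_neg] at hshift
    have hεC : (C ε * C ε : PowerSeries ℂ) = 1 := by rw [← map_mul, hε, map_one]
    have hQt : Q t = R t - C (φ t) * (X ^ 2 * R t ^ 2) := rfl
    linear_combination hshift - hQt - X * (mk fun i => coeff (i + 1) (Q t)) * hεC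

end Recursion

theorem vanishingLemma
    (N : ℕ) (hN : 1 ≤ N)
    (φ₁ φ₂ : ℝ → ℂ)
    (hper1 : Function.Periodic φ₁ 1) (hper2 : Function.Periodic φ₂ 1)
    (hsm1 : ContDiff ℝ N φ₁) (hsm2 : ContDiff ℝ N φ₂)
    (r : ℕ → ℝ → ℂ)
    (hr1 : ∀ t : ℝ, r 1 t = -φ₂ t)
    (hrrec : ∀ n : ℕ, 1 ≤ n → n ≤ N → ∀ t : ℝ,
      r (n + 1) t = deriv (r n) t + φ₁ t * ∑ k ∈ Finset.Ico 1 n, r k t * r (n - k) t)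
    (s : ℕ → ℝ → ℂ)
    (hs1 : ∀ t : ℝ, s 1 t = -φ₁ t)
    (hsrec : ∀ n : ℕ, 1 ≤ n → n ≤ N → ∀ t : ℝ,
      s (n + 1) t = -deriv (s n) t + φ₂ t * ∑ k ∈ Finset.Ico 1 n, s k t * s (n - k) t)
    :
    ∀ k : ℕ, 1 ≤ k → k ≤ N + 1 →
      ∫ t in (0:ℝ)..1, φ₁ t * r k t = ∫ t in (0:ℝ)..1, φ₂ t * s k t := by
  intro k hk hkN
  have hrrec' : ∀ n : ℕ, 1 ≤ n → n ≤ N → ∀ t : ℝ,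
      r (n + 1) t = 1 * deriv (r n) t + φ₁ t * ∑ k ∈ Finset.Ico 1 n, r k t * r (n - k) t := by
    simpa only [one_mul] using hrrec
  have hsrec' : ∀ n : ℕ, 1 ≤ n → n ≤ N → ∀ t : ℝ,
      s (n + 1) t = (-1) * deriv (s n) t +
        φ₂ t * ∑ k ∈ Finset.Ico 1 n, s k t * s (n - k) t := by
    simpa only [neg_one_mul] using hsrec
  obtain ⟨R, R', hRc, hRp, hRd, hR⟩ :=
    exists_riccati_series hsm1 hsm2 hper1 hper2 (by norm_num) hr1 hrrec'
  obtain ⟨S, S', hSc, hSp, hSd, hS⟩ :=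
    exists_riccati_series hsm2 hsm1 hper2 hper1 (by norm_num) hs1 hsrec'
  have hrcont : Continuous fun t => φ₁ t * r k t := hsm1.continuous.mul
    (contDiff_of_riccati_recursion hsm1 hsm2 hr1 hrrec' k hk hkN).continuous
  have hscont : Continuous fun t => φ₂ t * s k t := hsm2.continuous.mul
    (contDiff_of_riccati_recursion hsm2 hsm1 hs1 hsrec' k hk hkN).continuous
  open PowerSeries in
  have hderiv : ∀ t, HasDerivAt (fun x => ∑ j ∈ Finset.range k,
      (-1) ^ j / (j + 1 : ℂ) * coeff k ((X ^ 2 * (R x * S x)) ^ (j + 1)))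
      (φ₂ t * s k t - φ₁ t * r k t) t := by
    intro t
    have hRS := ((hRd t).mul (hSd t)).X_pow_mul 2
    have hRt := hR t
    have hSt := hS t
    simp only [map_neg, map_one] at hRt hSt
    have hG : (X ^ 2 * (R' t * S t + R t * S' t) : PowerSeries ℂ) =
        (1 + X ^ 2 * (R t * S t)) * (X * (C (φ₂ t) * S t - C (φ₁ t) * R t)) := by
      linear_combination -X * S t * hRt + X * R t * hSt
    rw [hG] at hRS
    convert hRS.log_one_add (Dvd.dvd.mul_right (dvd_pow_self X two_ne_zero) _)
      (dvd_mul_right X _) (show k < N + 2 by omega) using 1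
    obtain ⟨q, rfl⟩ := Nat.exists_eq_add_of_le' hk
    rw [coeff_succ_X_mul, map_sub, coeff_C_mul, coeff_C_mul, hRc q (by omega),
      hSc q (by omega)]
  have hint := intervalIntegral.integral_eq_sub_of_hasDerivAt (a := 0) (b := 1)
    (fun t _ => hderiv t) ((hscont.sub hrcont).intervalIntegrable 0 1)
  rw [hRp, hSp, sub_self, intervalIntegral.integral_sub (hscont.intervalIntegrable 0 1)
    (hrcont.intervalIntegrable 0 1)] at hint
  exact (sub_eq_zero.1 hint).symm
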